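/- For every dimension n ≥ 2 there exist constants c₀ > 0, ε₀ > 0 and c > 0 (depending only on n) with the following property. Let λ > 0, r > 0, x₀ ∈ ℝⁿ, and let u be a λ-eigenfunction on an open neighborhood of the closed ball of center x₀ and radius r. Suppose Ω ⊆ B(x₀, r) is an open set which is c₀-narrow on scale 1/√λ and u = 0 on (∂Ω) ∩ B(x₀, r). If ε ∈ (0, ε₀] and |Ω| ≤ ε^{n−1}·|B(x₀, r)|, then sup_{Ω ∩ B(x₀, r/2)} |u| ≤ e^{−c/ε}·sup_{Ω ∩ B(x₀, r)} |u|. -/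

import Mathlib

open MeasureTheory Metric Set

/-- The Euclidean Laplacian `Δu = ∑ⱼ ∂²u/∂xⱼ²` of `u : ℝⁿ → ℝ`. -/
noncomputable def lapl (n : ℕ) (u : EuclideanSpace ℝ (Fin n) → ℝ)
    (x : EuclideanSpace ℝ (Fin n)) : ℝ :=
  ∑ j : Fin n,
    fderiv ℝ (fun y => fderiv ℝ u y (EuclideanSpace.single j (1:ℝ))) x
      (EuclideanSpace.single j (1:ℝ))

/-- `Ω` is `c₀`-narrow on scale `s`: every ball of radius `s` centered at a point of the
closure of `Ω` meets `Ω` in measure at most `c₀` times the measure of the ball. -/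
def IsNarrow (n : ℕ) (c₀ s : ℝ) (Ω : Set (EuclideanSpace ℝ (Fin n))) : Prop :=
  ∀ y ∈ closure Ω,
    (volume (Ω ∩ ball y s)).toReal ≤ c₀ * (volume (ball y s)).toReal

lemma hasDerivAt_max_zero_pow (p : ℕ) (x : ℝ) :
    HasDerivAt (fun t : ℝ => max t 0 ^ (p + 2)) ((p + 2) * max x 0 ^ (p + 1)) x := by
  rcases lt_trichotomy x 0 with h | h | h
  · have : (fun t : ℝ => max t 0 ^ (p + 2)) =ᶠ[nhds x] fun _ => 0 := by
      filter_upwards [gt_mem_nhds h] with t ht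
      simp [max_eq_right ht.le]
    rw [max_eq_right h.le]
    simpa using (hasDerivAt_const x (0 : ℝ)).congr_of_eventuallyEq this
  · subst h
    have : (fun t : ℝ => max t 0 ^ (p + 2)) =O[nhds 0] fun t => ‖t - 0‖ ^ (p + 2) := by
      refine Asymptotics.IsBigO.of_bound 1 (Filter.Eventually.of_forall fun t => ?_)
      simp only [sub_zero, norm_pow, norm_norm, one_mul]
      gcongr
      simp only [Real.norm_eq_abs]
      rw [abs_of_nonneg (le_max_right t 0)]
      exact max_le (le_abs_self t) (abs_nonneg t)
    simpa using (this.hasFDerivAt (by omega)).hasDerivAt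
  · have : (fun t : ℝ => max t 0 ^ (p + 2)) =ᶠ[nhds x] fun t => t ^ (p + 2) := by
      filter_upwards [lt_mem_nhds h] with t ht
      simp [max_eq_left ht.le]
    rw [max_eq_left h.le]
    simpa using (hasDerivAt_pow (p + 2) x).congr_of_eventuallyEq this

lemma contDiff_max_zero_cube : ContDiff ℝ 2 (fun t : ℝ => max t 0 ^ 3) := by
  have h3 := hasDerivAt_max_zero_pow 1
  have h2 := hasDerivAt_max_zero_pow 0
  norm_num at h3 h2
  have e : (2 : WithTop ℕ∞) = 1 + 1 := by norm_num
  rw [e, contDiff_succ_iff_deriv]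
  refine ⟨fun x => (h3 x).differentiableAt, by simp, ?_⟩
  rw [show deriv (fun t : ℝ => max t 0 ^ 3) = fun x => 3 * max x 0 ^ 2 from
    funext fun x => (h3 x).deriv]
  refine contDiff_const.mul ?_
  rw [contDiff_one_iff_deriv]
  refine ⟨fun x => (h2 x).differentiableAt, ?_⟩
  rw [show deriv (fun t : ℝ => max t 0 ^ 2) = fun x => 2 * max x 0 from
    funext fun x => (h2 x).deriv]
  fun_prop

/-- A radial `C¹` weight whose gradient at `z` is `-radialDensity z • z`. -/
noncomputable def radialWeight {E : Type*} [NormedAddCommGroup E] (z : E) : ℝ :=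
  max (1 - ‖z‖ ^ 2) 0 ^ 3 / 6

/-- The radial density `(1 - |z|²)₊²`. -/
noncomputable def radialDensity {E : Type*} [NormedAddCommGroup E] (z : E) : ℝ :=
  max (1 - ‖z‖ ^ 2) 0 ^ 2

section Radial

variable {E : Type*} [NormedAddCommGroup E]

lemma radialWeight_nonneg (z : E) : 0 ≤ radialWeight z := by
  unfold radialWeight; positivity

lemma radialDensity_nonneg (z : E) : 0 ≤ radialDensity z := by
  unfold radialDensity; positivity

lemma radialDensity_le_one (z : E) : radialDensity z ≤ 1 := by
  unfold radialDensity
  exact pow_le_one₀ (le_max_right _ _) (max_le (by nlinarith [sq_nonneg ‖z‖]) zero_le_one)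

lemma norm_lt_one_of_max_ne_zero {z : E} (h : max (1 - ‖z‖ ^ 2) 0 ≠ 0) : ‖z‖ < 1 := by
  by_contra! h1
  exact h (max_eq_right (by nlinarith))

lemma norm_lt_one_of_radialWeight_ne_zero {z : E} (h : radialWeight z ≠ 0) : ‖z‖ < 1 :=
  norm_lt_one_of_max_ne_zero fun h0 => h (by simp [radialWeight, h0])

lemma norm_lt_one_of_radialDensity_ne_zero {z : E} (h : radialDensity z ≠ 0) : ‖z‖ < 1 :=
  norm_lt_one_of_max_ne_zero fun h0 => h (by simp [radialDensity, h0])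

lemma continuous_radialWeight : Continuous (radialWeight : E → ℝ) := by
  unfold radialWeight; fun_prop

lemma continuous_radialDensity : Continuous (radialDensity : E → ℝ) := by
  unfold radialDensity; fun_prop

lemma hasCompactSupport_radialWeight [ProperSpace E] :
    HasCompactSupport (radialWeight : E → ℝ) :=
  HasCompactSupport.intro (isCompact_closedBall (0 : E) 1) fun z hz => by
    by_contra h
    exact hz (by simpa using (norm_lt_one_of_radialWeight_ne_zero h).le)

lemma hasCompactSupport_radialDensity [ProperSpace E] :
    HasCompactSupport (radialDensity : E → ℝ) :=
  HasCompactSupport.intro (isCompact_closedBall (0 : E) 1) fun z hz => by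
    by_contra h
    exact hz (by simpa using (norm_lt_one_of_radialDensity_ne_zero h).le)

lemma hasFDerivAt_radialWeight [InnerProductSpace ℝ E] (z : E) :
    HasFDerivAt radialWeight (-(radialDensity z) • innerSL ℝ z) z := by
  have h1 : HasFDerivAt (fun z : E => 1 - ‖z‖ ^ 2) (-(2 • innerSL ℝ z)) z :=
    (hasStrictFDerivAt_norm_sq z).hasFDerivAt.const_sub 1
  have h3 := ((hasDerivAt_max_zero_pow 1 (1 - ‖z‖ ^ 2)).comp_hasFDerivAt z h1).mul_const (1 / 6)
  have e : (radialWeight : E → ℝ) = fun z =>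
      ((fun t : ℝ => max t 0 ^ (1 + 2)) ∘ fun z : E => 1 - ‖z‖ ^ 2) z * (1 / 6) := by
    ext z; simp [radialWeight]; ring
  rw [e]
  refine h3.congr_fderiv ?_
  ext v
  simp [radialDensity]
  ring

end Radial

lemma integral_radialDensity_pos (n : ℕ) :
    0 < ∫ z : EuclideanSpace ℝ (Fin n), radialDensity z := by
  refine continuous_radialDensity.integral_pos_of_hasCompactSupport_nonneg_nonzero
    hasCompactSupport_radialDensity radialDensity_nonneg (x := 0) ?_
  simp [radialDensity]

section MeanValue

variable {n : ℕ}

local notation "𝔼" => EuclideanSpace ℝ (Fin n)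

lemma integral_fderiv_mul_radialDensity {f : 𝔼 → ℝ} (hf : ContDiff ℝ 2 f) (y : 𝔼) (t : ℝ) :
    ∫ z : 𝔼, fderiv ℝ f (y + t • z) z * radialDensity z =
      t * ∫ z : 𝔼, lapl n f (y + t • z) * radialWeight z := by
  set e : Fin n → 𝔼 := fun j => EuclideanSpace.single j (1 : ℝ) with he
  have hd : ∀ j, ContDiff ℝ 1 fun x => fderiv ℝ f x (e j) := fun j =>
    (hf.fderiv_right (m := 1) (by norm_num)).clm_apply contDiff_const
  have hA : ContDiff ℝ 1 fun z : 𝔼 => y + t • z := by fun_prop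
  have hg : ∀ j, ContDiff ℝ 1 fun z : 𝔼 => fderiv ℝ f (y + t • z) (e j) :=
    fun j => (hd j).comp hA
  have hgd : ∀ j (z : 𝔼), fderiv ℝ (fun z : 𝔼 => fderiv ℝ f (y + t • z) (e j)) z (e j) =
      t * fderiv ℝ (fun x => fderiv ℝ f x (e j)) (y + t • z) (e j) := by
    intro j z
    have h1 : HasFDerivAt (fun z : 𝔼 => y + t • z) (t • ContinuousLinearMap.id ℝ 𝔼) z :=
      ((hasFDerivAt_id z).const_smul t).const_add y
    have h2 := (((hd j).differentiable (by norm_num)) (y + t • z)).hasFDerivAt.comp z h1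
    have h3 : fderiv ℝ (fun z : 𝔼 => fderiv ℝ f (y + t • z) (e j)) z = _ := h2.fderiv
    rw [h3]
    simp
  have hWd : ∀ j (z : 𝔼), fderiv ℝ radialWeight z (e j) = -(radialDensity z * z j) := by
    intro j z
    rw [(hasFDerivAt_radialWeight z).fderiv]
    simp [e, EuclideanSpace.inner_single_right]
  have hcg : ∀ j, Continuous fun z : 𝔼 => fderiv ℝ f (y + t • z) (e j) := fun j => (hg j).continuous
  have hcg' : ∀ j, Continuous fun z : 𝔼 =>
      fderiv ℝ (fun z : 𝔼 => fderiv ℝ f (y + t • z) (e j)) z (e j) := fun j =>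
    ((hg j).continuous_fderiv (by norm_num)).clm_apply continuous_const
  have hcW := continuous_radialWeight (E := 𝔼)
  have hcD := continuous_radialDensity (E := 𝔼)
  have hsW := hasCompactSupport_radialWeight (E := 𝔼)
  have hsD := hasCompactSupport_radialDensity (E := 𝔼)
  have hcz : ∀ j, Continuous fun z : 𝔼 => z j := fun j => by fun_prop
  have i1 : ∀ j, Integrable fun z : 𝔼 =>
      fderiv ℝ (fun z : 𝔼 => fderiv ℝ f (y + t • z) (e j)) z (e j) * radialWeight z := fun j =>
    ((hcg' j).mul hcW).integrable_of_hasCompactSupport hsW.mul_left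
  have i2 : ∀ j, Integrable fun z : 𝔼 => fderiv ℝ f (y + t • z) (e j) * (z j * radialDensity z) :=
    fun j => ((hcg j).mul ((hcz j).mul hcD)).integrable_of_hasCompactSupport
      hsD.mul_left.mul_left
  have key : ∀ j, ∫ z : 𝔼, fderiv ℝ f (y + t • z) (e j) * (z j * radialDensity z) =
      ∫ z : 𝔼, fderiv ℝ (fun z : 𝔼 => fderiv ℝ f (y + t • z) (e j)) z (e j) * radialWeight z := by
    intro j
    have h := integral_mul_fderiv_eq_neg_fderiv_mul_of_integrable (μ := volume)
      (f := fun z : 𝔼 => fderiv ℝ f (y + t • z) (e j)) (g := radialWeight) (v := e j)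
      (i1 j) ?_ ?_ (fun z _ => (hg j).differentiable (by norm_num) z)
      (fun z _ => (hasFDerivAt_radialWeight z).differentiableAt)
    · rw [← neg_inj, ← h, ← integral_neg]
      refine integral_congr_ae (Filter.Eventually.of_forall fun z => ?_)
      simp only [hWd]
      ring
    · refine (i2 j).neg.congr (Filter.Eventually.of_forall fun z => ?_)
      simp only [hWd, Pi.neg_apply]
      ring
    · exact ((hcg j).mul hcW).integrable_of_hasCompactSupport hsW.mul_left
  have hz : ∀ z : 𝔼, fderiv ℝ f (y + t • z) z * radialDensity z =
      ∑ j, fderiv ℝ f (y + t • z) (e j) * (z j * radialDensity z) := by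
    intro z
    have hs : ∑ j, z j • e j = z := by
      simpa [e] using (EuclideanSpace.basisFun (Fin n) ℝ).sum_repr z
    have h := congrArg (fderiv ℝ f (y + t • z)) hs
    rw [← h, map_sum, Finset.sum_mul]
    refine Finset.sum_congr rfl fun j _ => ?_
    rw [map_smul, smul_eq_mul]
    ring
  simp only [hz]
  rw [integral_finsetSum _ fun j _ => i2 j, ← integral_const_mul]
  simp only [key]
  rw [← integral_finsetSum _ fun j _ => i1 j]
  refine integral_congr_ae (Filter.Eventually.of_forall fun z => ?_)
  simp only [hgd, lapl, Finset.sum_mul, Finset.mul_sum]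
  refine Finset.sum_congr rfl fun j _ => ?_
  simp only [he]
  ring

lemma continuous_lapl {f : 𝔼 → ℝ} (hf : ContDiff ℝ 2 f) : Continuous (lapl n f) := by
  unfold lapl
  refine continuous_finsetSum _ fun j _ => ?_
  have : ContDiff ℝ 1 fun x => fderiv ℝ f x (EuclideanSpace.single j (1 : ℝ)) :=
    (hf.fderiv_right (m := 1) (by norm_num)).clm_apply contDiff_const
  exact (this.continuous_fderiv (by norm_num)).clm_apply continuous_const

lemma hasDerivAt_integral_comp_mul_radialDensity {f : 𝔼 → ℝ} (hf : ContDiff ℝ 2 f)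
    (hc : HasCompactSupport f) (y : 𝔼) (t : ℝ) :
    HasDerivAt (fun t : ℝ => ∫ z : 𝔼, f (y + t • z) * radialDensity z)
      (t * ∫ z : 𝔼, lapl n f (y + t • z) * radialWeight z) t := by
  rw [← integral_fderiv_mul_radialDensity hf]
  have hcD := continuous_radialDensity (E := 𝔼)
  have hsD := hasCompactSupport_radialDensity (E := 𝔼)
  have hf' : Continuous (fderiv ℝ f) := hf.continuous_fderiv (by norm_num)
  obtain ⟨C, hC⟩ := (hc.fderiv ℝ).exists_bound_of_continuous hf'
  have hfc := hf.continuous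
  have hcont : ∀ t : ℝ, Continuous fun z : 𝔼 => f (y + t • z) * radialDensity z := fun t => by
    fun_prop
  refine (hasDerivAt_integral_of_dominated_loc_of_deriv_le (μ := volume) (s := univ)
    (F := fun t z => f (y + t • z) * radialDensity z)
    (F' := fun t z => fderiv ℝ f (y + t • z) z * radialDensity z)
    (bound := fun z => C * ‖z‖ * radialDensity z)
    Filter.univ_mem (Filter.Eventually.of_forall fun t => (hcont t).aestronglyMeasurable)
    ((hcont t).integrable_of_hasCompactSupport hsD.mul_left) ?_ ?_ ?_ ?_).2
  · exact (Continuous.mul (by fun_prop) hcD).aestronglyMeasurable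
  · refine Filter.Eventually.of_forall fun z t _ => ?_
    rw [norm_mul, Real.norm_of_nonneg (radialDensity_nonneg z)]
    refine mul_le_mul_of_nonneg_right ?_ (radialDensity_nonneg z)
    exact ((fderiv ℝ f (y + t • z)).le_opNorm z).trans
      (mul_le_mul_of_nonneg_right (hC _) (norm_nonneg z))
  · exact (Continuous.mul (by fun_prop) hcD).integrable_of_hasCompactSupport hsD.mul_left
  · refine Filter.Eventually.of_forall fun z t _ => ?_
    have h1 : HasDerivAt (fun t : ℝ => y + t • z) z t := by
      simpa using ((hasDerivAt_id t).smul_const z).const_add y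
    exact ((hf.differentiable (by norm_num) (y + t • z)).hasFDerivAt.comp_hasDerivAt t
      h1).mul_const _

/-- A weighted mean value inequality for functions whose Laplacian is bounded below. -/
lemma mul_integral_radialDensity_le {f : 𝔼 → ℝ} (hf : ContDiff ℝ 2 f)
    (hc : HasCompactSupport f) (y : 𝔼) {s L : ℝ} (hs : 0 < s)
    (hL : ∀ x ∈ ball y s, -L ≤ lapl n f x) :
    f y * (∫ z : 𝔼, radialDensity z) ≤
      (∫ z : 𝔼, f (y + s • z) * radialDensity z) +
        L * s ^ 2 / 2 * ∫ z : 𝔼, radialWeight z := by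
  have hcW := continuous_radialWeight (E := 𝔼)
  have hsW := hasCompactSupport_radialWeight (E := 𝔼)
  have hlap := continuous_lapl hf
  set W := ∫ z : 𝔼, radialWeight z with hW
  have hd : ∀ t, HasDerivAt (fun t : ℝ => (∫ z : 𝔼, f (y + t • z) * radialDensity z) +
      L * t ^ 2 / 2 * W) (t * (∫ z : 𝔼, lapl n f (y + t • z) * radialWeight z) + t * (L * W)) t := by
    intro t
    have h2 : HasDerivAt (fun t : ℝ => L * t ^ 2 / 2 * W) (t * (L * W)) t := by
      have := ((((hasDerivAt_id t).pow 2).const_mul L).div_const 2).mul_const W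
      refine this.congr_deriv ?_
      simp; ring
    exact (hasDerivAt_integral_comp_mul_radialDensity hf hc y t).add h2
  have hmono := monotoneOn_of_deriv_nonneg (convex_Icc 0 s)
    (fun t _ => (hd t).continuousAt.continuousWithinAt)
    (fun t _ => (hd t).differentiableAt.differentiableWithinAt) (fun t ht => by
      rw [interior_Icc] at ht
      rw [(hd t).deriv, ← mul_add]
      refine mul_nonneg ht.1.le ?_
      rw [hW, ← integral_const_mul, ← integral_add]
      · refine integral_nonneg fun z => ?_
        show 0 ≤ lapl n f (y + t • z) * radialWeight z + L * radialWeight z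
        rw [← add_mul]
        by_cases h0 : radialWeight z = 0
        · simp [h0]
        · refine mul_nonneg ?_ (radialWeight_nonneg z)
          have hz := norm_lt_one_of_radialWeight_ne_zero h0
          have := hL (y + t • z) (by
            rw [mem_ball, dist_eq_norm, add_sub_cancel_left, norm_smul, Real.norm_of_nonneg ht.1.le]
            nlinarith [norm_nonneg z, ht.1, ht.2])
          linarith
      · exact (Continuous.mul (by fun_prop) hcW).integrable_of_hasCompactSupport hsW.mul_left
      · exact (continuous_const.mul hcW).integrable_of_hasCompactSupport hsW.mul_left)
  have h := hmono (left_mem_Icc.2 hs.le) (right_mem_Icc.2 hs.le) hs.le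
  simp only [zero_smul, add_zero, integral_const_mul] at h
  simpa using h

end MeanValue

section Truncation

variable {n : ℕ}

local notation "𝔼" => EuclideanSpace ℝ (Fin n)

lemma lapl_congr {f g : 𝔼 → ℝ} {x : 𝔼} (h : f =ᶠ[nhds x] g) : lapl n f x = lapl n g x := by
  unfold lapl
  refine Finset.sum_congr rfl fun j _ => ?_
  have h1 : (fun y => fderiv ℝ f y (EuclideanSpace.single j (1 : ℝ))) =ᶠ[nhds x]
      fun y => fderiv ℝ g y (EuclideanSpace.single j (1 : ℝ)) := by
    filter_upwards [h.fderiv (𝕜 := ℝ)] with y hy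
    rw [hy]
  rw [h1.fderiv_eq]

lemma lapl_zero (x : 𝔼) : lapl n (fun _ => (0 : ℝ)) x = 0 := by
  simp [lapl]

lemma lapl_neg (f : 𝔼 → ℝ) (x : 𝔼) : lapl n (fun x => -f x) x = -lapl n f x := by
  have h1 : ∀ y, fderiv ℝ (fun x => -f x) y = -fderiv ℝ f y := fun y => fderiv_fun_neg (f := f)
  simp only [lapl, h1, neg_apply, ← Finset.sum_neg_distrib]
  exact Finset.sum_congr rfl fun j _ => by rw [fderiv_fun_neg, neg_apply]

lemma le_lapl_max_sub_cube {u : 𝔼 → ℝ} (hu : ContDiff ℝ 2 u) (a : ℝ) (x : 𝔼) :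
    3 * max (u x - a) 0 ^ 2 * lapl n u x ≤ lapl n (fun x => max (u x - a) 0 ^ 3) x := by
  have hud : ∀ x, HasFDerivAt (fun x => u x - a) (fderiv ℝ u x) x := fun x =>
    (hu.differentiable (by norm_num) x).hasFDerivAt.sub_const a
  have h3 : ∀ x, fderiv ℝ (fun x => max (u x - a) 0 ^ 3) x =
      (3 * max (u x - a) 0 ^ 2) • fderiv ℝ u x := by
    intro x
    refine HasFDerivAt.fderiv ?_
    have := (hasDerivAt_max_zero_pow 1 (u x - a)).comp_hasFDerivAt x (hud x)
    norm_num at this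
    exact this
  have h2 : ∀ x, HasFDerivAt (fun x => 3 * max (u x - a) 0 ^ 2)
      ((6 * max (u x - a) 0) • fderiv ℝ u x) x := by
    intro x
    have := ((hasDerivAt_max_zero_pow 0 (u x - a)).comp_hasFDerivAt x (hud x)).const_mul 3
    norm_num [smul_smul] at this
    refine this.congr_fderiv ?_
    congr 1
    ring
  unfold lapl
  rw [Finset.mul_sum]
  refine Finset.sum_le_sum fun j _ => ?_
  set e : 𝔼 := EuclideanSpace.single j (1 : ℝ)
  have hd : ContDiff ℝ 1 fun x => fderiv ℝ u x e :=
    (hu.fderiv_right (m := 1) (by norm_num)).clm_apply contDiff_const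
  have hmul := (h2 x).mul (hd.differentiable (by norm_num) x).hasFDerivAt
  have : (fun y => fderiv ℝ (fun x => max (u x - a) 0 ^ 3) y e) =
      (fun x => 3 * max (u x - a) 0 ^ 2) * fun x => fderiv ℝ u x e := by
    ext y
    simp [h3]
  rw [this, hmul.fderiv]
  simp only [add_apply, smul_apply, smul_eq_mul]
  have : 0 ≤ max (u x - a) 0 := le_max_right _ _
  nlinarith [mul_nonneg this (sq_nonneg (fderiv ℝ u x e))]

lemma indicator_max_sub_cube_eventuallyEq {D : Set 𝔼} (hD : IsOpen D) {u : 𝔼 → ℝ}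
    (hu : Continuous u) {a : ℝ} {x : 𝔼} (hx : x ∈ frontier D → u x < a) :
    (x ∈ D ∧ D.indicator (fun x => max (u x - a) 0 ^ 3) =ᶠ[nhds x]
        fun x => max (u x - a) 0 ^ 3) ∨
      (x ∉ D ∧ D.indicator (fun x => max (u x - a) 0 ^ 3) =ᶠ[nhds x] fun _ => 0) := by
  by_cases h : x ∈ D
  · left
    refine ⟨h, ?_⟩
    filter_upwards [hD.mem_nhds h] with z hz
    simp [hz]
  right
  refine ⟨h, ?_⟩
  by_cases hc : x ∈ closure D
  · have : u x < a := hx (by rw [hD.frontier_eq]; exact ⟨hc, h⟩)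
    filter_upwards [hu.continuousAt.eventually_lt continuousAt_const this] with z hz
    by_cases hz' : z ∈ D
    · simp [hz', max_eq_right (sub_neg.2 hz).le]
    · simp [hz']
  · filter_upwards [isClosed_closure.isOpen_compl.mem_nhds hc] with z hz
    have : z ∉ D := fun h => hz (subset_closure h)
    simp [this]

lemma volume_ball_toReal (y : 𝔼) {s : ℝ} (hs : 0 < s) :
    (volume (ball y s)).toReal = s ^ n * (volume (ball (0 : 𝔼) 1)).toReal := by
  rw [Measure.addHaar_ball_of_pos _ _ hs, ENNReal.toReal_mul,
    ENNReal.toReal_ofReal (by positivity)]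
  simp

lemma volume_preimage_affine {A : Set 𝔼} (y : 𝔼) {s : ℝ} (hs : 0 < s) :
    (volume {z : 𝔼 | y + s • z ∈ A}).toReal = (volume A).toReal / s ^ n := by
  have h1 : {z : 𝔼 | y + s • z ∈ A} = preimage (s • ·) (preimage (y + ·) A) := rfl
  rw [h1, Measure.addHaar_preimage_smul _ hs.ne', measure_preimage_add, ENNReal.toReal_mul,
    ENNReal.toReal_ofReal (abs_nonneg _), abs_of_nonneg (by positivity)]
  simp
  ring

lemma max_sub_cube_le {D : Set 𝔼} (hD : IsOpen D) {u : 𝔼 → ℝ} (hu : ContDiff ℝ 2 u) {y : 𝔼}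
    {s s' a M L : ℝ} (hs : 0 < s) (hss : s < s') (ha : 0 ≤ a) (hL0 : 0 ≤ L) (hy : y ∈ D)
    (hfr : ∀ x ∈ frontier D ∩ ball y s', u x < a) (hM : ∀ x ∈ D, |u x| ≤ M)
    (hL : ∀ x ∈ D ∩ ball y s, -L ≤ lapl n u x) :
    max (u y - a) 0 ^ 3 * (∫ z : 𝔼, radialDensity z) ≤
      M ^ 3 * ((volume (D ∩ ball y s)).toReal / s ^ n) +
        3 * M ^ 2 * L * s ^ 2 / 2 * ∫ z : 𝔼, radialWeight z := by
  have hM0 : 0 ≤ M := (abs_nonneg _).trans (hM y hy)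
  have hmax : ∀ x ∈ D, max (u x - a) 0 ≤ M := fun x hx =>
    max_le (by linarith [(le_abs_self (u x)).trans (hM x hx)]) hM0
  set g : 𝔼 → ℝ := D.indicator (fun x => max (u x - a) 0 ^ 3) with hg
  let χ : ContDiffBump y := ⟨s, (s + s') / 2, hs, by linarith⟩
  have hloc := fun x (hx : x ∈ ball y s') =>
    indicator_max_sub_cube_eventuallyEq hD hu.continuous (x := x) (fun h => hfr x ⟨h, hx⟩)
  have hts : tsupport χ ⊆ ball y s' := by
    rw [χ.tsupport_eq]
    exact closedBall_subset_ball (by show (s + s') / 2 < s'; linarith)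
  have hcube : ContDiff ℝ 2 fun x => max (u x - a) 0 ^ 3 :=
    contDiff_max_zero_cube.comp (hu.sub contDiff_const)
  have hf : ContDiff ℝ 2 fun x => χ x * g x := by
    rw [contDiff_iff_contDiffAt]
    intro x
    by_cases hx : x ∈ tsupport χ
    · refine χ.contDiff.contDiffAt.mul ?_
      rcases hloc x (hts hx) with ⟨_, h⟩ | ⟨_, h⟩
      · exact hcube.contDiffAt.congr_of_eventuallyEq h
      · exact contDiffAt_const.congr_of_eventuallyEq h
    · refine (contDiffAt_const (c := (0 : ℝ))).congr_of_eventuallyEq ?_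
      filter_upwards [notMem_tsupport_iff_eventuallyEq.1 hx] with z hz
      simp [hz]
  have hχ1 : ∀ x ∈ closedBall y s, χ x = 1 := fun x hx => χ.one_of_mem_closedBall hx
  have hlap : ∀ x ∈ ball y s, -(3 * M ^ 2 * L) ≤ lapl n (fun x => χ x * g x) x := by
    intro x hx
    have h1 : (fun x => χ x * g x) =ᶠ[nhds x] g := by
      filter_upwards [isOpen_ball.mem_nhds hx] with z hz
      rw [hχ1 z (ball_subset_closedBall hz), one_mul]
    rw [lapl_congr h1]
    rcases hloc x (ball_subset_ball hss.le hx) with ⟨hxD, h⟩ | ⟨_, h⟩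
    · rw [lapl_congr h]
      refine le_trans ?_ (le_lapl_max_sub_cube hu a x)
      have h2 : max (u x - a) 0 ^ 2 ≤ M ^ 2 :=
        pow_le_pow_left₀ (le_max_right _ _) (hmax x hxD) 2
      have h3 := hL x ⟨hxD, hx⟩
      nlinarith [mul_le_mul_of_nonneg_right h2 hL0,
        mul_le_mul_of_nonneg_left h3 (sq_nonneg (max (u x - a) 0))]
    · rw [lapl_congr h, lapl_zero]
      have : 0 ≤ 3 * M ^ 2 * L := by positivity
      linarith
  have key := mul_integral_radialDensity_le hf χ.hasCompactSupport.mul_right y hs hlap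
  have hgy : χ y * g y = max (u y - a) 0 ^ 3 := by
    rw [hχ1 y (mem_closedBall_self hs.le), one_mul, hg, indicator_of_mem hy]
  rw [hgy] at key
  refine key.trans (add_le_add_left ?_ _)
  set A : Set 𝔼 := {z | y + s • z ∈ D ∩ ball y s}
  have hAm : MeasurableSet A :=
    ((hD.inter isOpen_ball).preimage (by fun_prop : Continuous fun z : 𝔼 => y + s • z)).measurableSet
  have hAfin : volume A ≠ ⊤ := by
    refine ne_top_of_le_ne_top (measure_ball_lt_top (μ := volume) (x := (0 : 𝔼)) (r := 1)).ne
      (measure_mono fun z hz => ?_)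
    have := hz.2
    rw [mem_ball, dist_eq_norm, add_sub_cancel_left, norm_smul, Real.norm_of_nonneg hs.le] at this
    rw [mem_ball_zero_iff]
    by_contra! h
    nlinarith
  rw [← volume_preimage_affine y hs]
  calc ∫ z : 𝔼, χ (y + s • z) * g (y + s • z) * radialDensity z
      ≤ ∫ z : 𝔼, A.indicator (fun _ => M ^ 3) z := by
        refine integral_mono ?_ ?_ fun z => ?_
        · have := hf.continuous
          have hcD := continuous_radialDensity (E := 𝔼)
          exact ((this.comp (by fun_prop : Continuous fun z : 𝔼 => y + s • z)).mul
            hcD).integrable_of_hasCompactSupport hasCompactSupport_radialDensity.mul_left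
        · exact (integrable_indicator_iff hAm).2 (integrableOn_const hAfin)
        · have hB : 0 ≤ A.indicator (fun _ => M ^ 3) z :=
            indicator_nonneg (fun _ _ => by positivity) z
          show χ (y + s • z) * g (y + s • z) * radialDensity z ≤ _
          by_cases h0 : radialDensity z = 0
          · rwa [h0, mul_zero]
          by_cases hz : y + s • z ∈ D
          · have hz1 := norm_lt_one_of_radialDensity_ne_zero h0
            have hzA : z ∈ A := ⟨hz, by
              rw [mem_ball, dist_eq_norm, add_sub_cancel_left, norm_smul,
                Real.norm_of_nonneg hs.le]
              nlinarith⟩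
            rw [indicator_of_mem hzA, hg, indicator_of_mem hz]
            have h2 : max (u (y + s • z) - a) 0 ^ 3 ≤ M ^ 3 :=
              pow_le_pow_left₀ (le_max_right _ _) (hmax _ hz) 3
            calc _ ≤ 1 * M ^ 3 * 1 := by
                  gcongr
                  · exact radialDensity_nonneg z
                  · exact χ.le_one
                  · exact radialDensity_le_one z
              _ = M ^ 3 := by ring
          · rw [hg, indicator_of_notMem hz]
            simpa using hB
    _ = M ^ 3 * (volume A).toReal := by
        rw [integral_indicator_const _ hAm]
        simp [Measure.real, mul_comm]

/-- A subsolution that is small on the boundary of a set of small density is small in it. -/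
lemma exists_density_bound (n : ℕ) : ∃ κ θ : ℝ, 0 < κ ∧ 0 < θ ∧
    ∀ (D : Set (EuclideanSpace ℝ (Fin n))) (u : EuclideanSpace ℝ (Fin n) → ℝ)
      (y : EuclideanSpace ℝ (Fin n)) (s s' lam m M : ℝ),
      IsOpen D → ContDiff ℝ 2 u → 0 < s → s < s' → 0 ≤ lam → lam * s ^ 2 ≤ κ → 0 ≤ m → y ∈ D →
      (∀ x ∈ frontier D ∩ ball y s', |u x| ≤ m) → (∀ x ∈ D, |u x| ≤ M) →
      (∀ x ∈ D, lapl n u x = -lam * u x) →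
      (volume (D ∩ ball y s)).toReal ≤ θ * (volume (ball y s)).toReal →
      |u y| ≤ m + M / 4 := by
  set I := ∫ z : EuclideanSpace ℝ (Fin n), radialDensity z
  set W := ∫ z : EuclideanSpace ℝ (Fin n), radialWeight z
  set V := (volume (ball (0 : EuclideanSpace ℝ (Fin n)) 1)).toReal
  have hI0 : 0 < I := integral_radialDensity_pos n
  have hW0 : 0 ≤ W := integral_nonneg fun z => radialWeight_nonneg z
  have hV0 : 0 < V := ENNReal.toReal_pos (measure_ball_pos _ _ one_pos).ne' measure_ball_lt_top.ne
  refine ⟨I / (192 * (W + 1)), I / (128 * V), by positivity, by positivity, ?_⟩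
  intro D u y s s' lam m M hD hu hs hss hlam hκ hm hy hfr hM hlap hvol
  have hM0 : 0 ≤ M := (abs_nonneg _).trans (hM y hy)
  have hq : (volume (D ∩ ball y s)).toReal / s ^ n ≤ I / 128 := by
    rw [div_le_iff₀ (by positivity)]
    refine hvol.trans (le_of_eq ?_)
    rw [volume_ball_toReal y hs]
    change _ * (_ * V) = _
    field_simp
  have main : ∀ v : EuclideanSpace ℝ (Fin n) → ℝ, ContDiff ℝ 2 v → (∀ x, |v x| = |u x|) →
      (∀ x ∈ D, lapl n v x = -lam * v x) → v y ≤ m + M / 4 := by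
    intro v hv hvu hvl
    refine le_of_forall_pos_le_add fun η hη => ?_
    have h := max_sub_cube_le hD hv (a := m + η) (M := M) (L := lam * M) hs hss (by positivity)
      (by positivity) hy
      (fun x hx => by linarith [le_abs_self (v x), hvu x, hfr x hx])
      (fun x hx => (hvu x).trans_le (hM x hx))
      (fun x hx => by
        rw [hvl x hx.1]
        have : v x ≤ M := (le_abs_self _).trans ((hvu x).trans_le (hM x hx.1))
        nlinarith [mul_le_mul_of_nonneg_left this hlam])
    have h1 : lam * s ^ 2 * W ≤ I / 192 := by
      calc lam * s ^ 2 * W ≤ I / (192 * (W + 1)) * W := by gcongr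
        _ ≤ I / (192 * (W + 1)) * (W + 1) := by gcongr; linarith
        _ = I / 192 := by field_simp
    have h2 : max (v y - (m + η)) 0 ^ 3 * I ≤ (M / 4) ^ 3 * I := by
      have e1 : M ^ 3 * ((volume (D ∩ ball y s)).toReal / s ^ n) ≤ M ^ 3 * (I / 128) := by gcongr
      have e2 : M ^ 3 * (lam * s ^ 2 * W) ≤ M ^ 3 * (I / 192) := by gcongr
      nlinarith
    have h3 : max (v y - (m + η)) 0 ≤ M / 4 :=
      le_of_pow_le_pow_left₀ (n := 3) (by norm_num) (by positivity) (le_of_mul_le_mul_right h2 hI0)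
    linarith [le_max_left (v y - (m + η)) 0]
  refine abs_le'.2 ⟨main u hu (fun _ => rfl) hlap, ?_⟩
  refine main (fun x => -u x) hu.neg (fun x => abs_neg _) fun x hx => ?_
  rw [lapl_neg, hlap x hx]
  ring

end Truncation

section Growth

variable {n : ℕ}

local notation "𝔼" => EuclideanSpace ℝ (Fin n)

lemma volume_inter_ball_sub_le {Ω : Set 𝔼} (hΩ : IsOpen Ω) (x₀ y : 𝔼) {ρ w s : ℝ}
    (hs : 0 < s) (hlo : ρ + s ≤ dist y x₀) (hhi : dist y x₀ + s ≤ ρ + w) :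
    (volume ((Ω ∩ ball x₀ (ρ + w)) ∩ ball y s)).toReal ≤
      (volume (Ω ∩ ball x₀ (ρ + w))).toReal - (volume (Ω ∩ ball x₀ ρ)).toReal := by
  have hfin : ∀ t, volume (Ω ∩ ball x₀ t) ≠ ⊤ := fun t =>
    ne_top_of_le_ne_top measure_ball_lt_top.ne (measure_mono inter_subset_right)
  have hfin' : volume ((Ω ∩ ball x₀ (ρ + w)) ∩ ball y s) ≠ ⊤ :=
    ne_top_of_le_ne_top (hfin _) (measure_mono inter_subset_left)
  have hdisj : Disjoint ((Ω ∩ ball x₀ (ρ + w)) ∩ ball y s) (Ω ∩ ball x₀ ρ) := by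
    rw [disjoint_left]
    rintro z ⟨_, hz⟩ ⟨_, hz'⟩
    rw [mem_ball] at hz hz'
    linarith [dist_triangle_left y x₀ z]
  rw [le_sub_iff_add_le, ← ENNReal.toReal_add hfin' (hfin _),
    ← measure_union hdisj (hΩ.inter isOpen_ball).measurableSet]
  refine ENNReal.toReal_mono (hfin _) (measure_mono (union_subset inter_subset_left ?_))
  exact inter_subset_inter_right _ (ball_subset_ball (by linarith))

/-- One step of the growth lemma: a function vanishing on the boundary of a narrow set drops by a
factor three across a spherical shell that meets the set in small measure. -/
lemma exists_growth_step (n : ℕ) : ∃ κ θ : ℝ, 0 < κ ∧ 0 < θ ∧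
    ∀ (Ω : Set (EuclideanSpace ℝ (Fin n))) (u : EuclideanSpace ℝ (Fin n) → ℝ)
      (x₀ : EuclideanSpace ℝ (Fin n)) (lam s₀ ρ w M : ℝ),
      IsOpen Ω → ContDiff ℝ 2 u → 0 ≤ lam → 0 < s₀ → lam * s₀ ^ 2 ≤ κ → 0 < w →
      (∀ y ∈ Ω, (volume (Ω ∩ ball y s₀)).toReal ≤ θ * (volume (ball y s₀)).toReal) →
      (∀ x ∈ frontier Ω ∩ ball x₀ (ρ + w), u x = 0) → (∀ x ∈ Ω, lapl n u x = -lam * u x) →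
      (∀ x ∈ Ω ∩ ball x₀ (ρ + w), |u x| ≤ M) →
      (volume (Ω ∩ ball x₀ (ρ + w))).toReal - (volume (Ω ∩ ball x₀ ρ)).toReal ≤
        θ * (volume (ball x₀ (w / 4))).toReal →
      ∀ x ∈ Ω ∩ ball x₀ ρ, |u x| ≤ M / 3 := by
  obtain ⟨κ, θ, hκ, hθ, H⟩ := exists_density_bound n
  refine ⟨κ, θ, hκ, hθ, ?_⟩
  intro Ω u x₀ lam s₀ ρ w M hΩ hu hlam hs₀ hsκ hw hnar hfr hlap hM hvol x hx
  have hM0 : 0 ≤ M := (abs_nonneg _).trans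
    (hM x ⟨hx.1, ball_subset_ball (by linarith) hx.2⟩)
  have hsub : ∀ D ⊆ Ω, ∀ y ∈ D, (volume (D ∩ ball y s₀)).toReal ≤
      θ * (volume (ball y s₀)).toReal := fun D hD y hy =>
    (ENNReal.toReal_mono (ne_top_of_le_ne_top measure_ball_lt_top.ne
      (measure_mono inter_subset_right)) (measure_mono (inter_subset_inter_left _ hD))).trans
      (hnar y (hD hy))
  have hsphere : ∀ y ∈ Ω, dist y x₀ = ρ + w / 2 → |u y| ≤ M / 4 := by
    intro y hy hyd
    have hyD : y ∈ Ω ∩ ball x₀ (ρ + w) := ⟨hy, by rw [mem_ball, hyd]; linarith⟩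
    have hs : 0 < min s₀ (w / 4) := by positivity
    have hsw : min s₀ (w / 4) ≤ w / 4 := min_le_right _ _
    have := H (Ω ∩ ball x₀ (ρ + w)) u y (min s₀ (w / 4)) (w / 2) lam 0 M
      (hΩ.inter isOpen_ball) hu hs (by linarith) hlam
      ((mul_le_mul_of_nonneg_left (pow_le_pow_left₀ hs.le (min_le_left _ _) 2) hlam).trans hsκ)
      le_rfl hyD ?_ hM (fun x hx => hlap x hx.1) ?_
    · simpa using this
    · rintro z ⟨hz, hzy⟩
      have hzB : z ∈ ball x₀ (ρ + w) := by
        rw [mem_ball] at hzy ⊢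
        linarith [dist_triangle z y x₀]
      rw [hfr z ⟨?_, hzB⟩, abs_zero]
      rcases frontier_inter_subset _ _ hz with h | h
      · exact h.1
      · rw [isOpen_ball.frontier_eq] at h
        exact absurd hzB h.2.2
    · rcases le_total s₀ (w / 4) with h | h
      · rw [min_eq_left h]
        exact hsub _ inter_subset_left y hyD
      · rw [min_eq_right h]
        refine (volume_inter_ball_sub_le hΩ x₀ y (by positivity) ?_ ?_).trans (hvol.trans (le_of_eq ?_))
        · linarith
        · linarith
        · rw [volume_ball_toReal y (by positivity), volume_ball_toReal x₀ (by positivity)]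
  set D := Ω ∩ ball x₀ (ρ + w / 2)
  have hDsub : D ⊆ Ω ∩ ball x₀ (ρ + w) :=
    inter_subset_inter_right _ (ball_subset_ball (by linarith))
  have hfrD : ∀ z ∈ frontier D, |u z| ≤ M / 4 := by
    intro z hz
    have hzc : dist z x₀ ≤ ρ + w / 2 :=
      closure_ball_subset_closedBall (closure_mono inter_subset_right hz.1)
    have hzB : z ∈ ball x₀ (ρ + w) := by rw [mem_ball]; linarith
    by_cases hzΩ : z ∈ Ω
    · refine hsphere z hzΩ (le_antisymm hzc ?_)
      by_contra! h
      rw [(hΩ.inter isOpen_ball).frontier_eq] at hz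
      exact hz.2 ⟨hzΩ, h⟩
    · rw [hfr z ⟨?_, hzB⟩, abs_zero]
      · positivity
      · rw [hΩ.frontier_eq]
        exact ⟨closure_mono inter_subset_left hz.1, hzΩ⟩
  have hxD : x ∈ D := ⟨hx.1, ball_subset_ball (by linarith) hx.2⟩
  have hbdd : BddAbove (image (fun x => |u x|) D) := ⟨M, by
    rintro _ ⟨z, hz, rfl⟩
    exact hM z (hDsub hz)⟩
  set S := sSup (image (fun x => |u x|) D)
  have hle : ∀ z ∈ D, |u z| ≤ S := fun z hz => le_csSup hbdd (mem_image_of_mem _ hz)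
  have hS2 : S ≤ M / 4 + S / 4 := by
    refine csSup_le ⟨_, mem_image_of_mem _ hxD⟩ ?_
    rintro _ ⟨z, hz, rfl⟩
    exact H D u z s₀ (s₀ + 1) lam (M / 4) S (hΩ.inter isOpen_ball) hu hs₀ (by linarith) hlam hsκ
      (by positivity) hz (fun x hx => hfrD x hx.1) hle (fun x hx => hlap x hx.1)
      (hsub D inter_subset_left z hz)
  linarith [hle x hxD]

lemma abs_le_exp_mul_of_steps {Ω : Set 𝔼} {u : 𝔼 → ℝ} {x₀ : 𝔼} {R X : ℕ → ℝ} (N : ℕ)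
    (hstep : ∀ k < N, ∀ M, (∀ x ∈ Ω ∩ ball x₀ (R (k + 1)), |u x| ≤ M) →
      ∀ x ∈ Ω ∩ ball x₀ (R k), |u x| ≤ Real.exp (-1 + X k) * M) {M : ℝ}
    (hM : ∀ x ∈ Ω ∩ ball x₀ (R N), |u x| ≤ M) :
    ∀ x ∈ Ω ∩ ball x₀ (R 0), |u x| ≤ Real.exp (-N + ∑ k ∈ Finset.range N, X k) * M := by
  induction N generalizing M with
  | zero => simpa using hM
  | succ N ih =>
    intro x hx
    refine (ih (fun k hk => hstep k (hk.trans N.lt_succ_self))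
      (hstep N N.lt_succ_self M hM) x hx).trans (le_of_eq ?_)
    rw [← mul_assoc, ← Real.exp_add, Finset.sum_range_succ]
    congr 2
    push_cast
    ring

lemma le_biSup_abs {u : 𝔼 → ℝ} {S : Set 𝔼} {B : ℝ} (hB : ∀ x ∈ S, |u x| ≤ B) {x : 𝔼}
    (hx : x ∈ S) : |u x| ≤ ⨆ x ∈ S, |u x| := by
  have hbdd : BddAbove (range fun x => ⨆ _ : x ∈ S, |u x|) := by
    refine ⟨max B 0, ?_⟩
    rintro _ ⟨z, rfl⟩
    exact Real.iSup_le (fun hz => (hB z hz).trans (le_max_left _ _)) (le_max_right _ _)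
  refine le_ciSup_of_le hbdd x ?_
  rw [ciSup_pos hx]

/-- The volume budget: the shells of width `r / (2N)` with `N = ⌊b / ε⌋` cannot be too full. -/
lemma volume_div_le {Ω : Set 𝔼} (x₀ : 𝔼) {r ε θ b : ℝ} {N : ℕ} (hn : 2 ≤ n) (hr : 0 < r)
    (hε : 0 < ε) (hθ : 0 < θ) (hN : 0 < N) (hb1 : b ≤ 1) (hbθ : b ≤ θ / (2 * 8 ^ n))
    (hNb : ε * N ≤ b)
    (hvol : (volume Ω).toReal ≤ ε ^ (n - 1) * (volume (ball x₀ r)).toReal) :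
    (volume Ω).toReal / (θ * (volume (ball x₀ (r / (2 * N) / 4))).toReal) ≤ N / 2 := by
  have hN' : (0 : ℝ) < N := by exact_mod_cast hN
  have hV : 0 < (volume (ball (0 : 𝔼) 1)).toReal :=
    ENNReal.toReal_pos (measure_ball_pos _ _ one_pos).ne' measure_ball_lt_top.ne
  rw [volume_ball_toReal x₀ hr] at hvol
  rw [volume_ball_toReal x₀ (by positivity)]
  set V := (volume (ball (0 : 𝔼) 1)).toReal
  rw [div_le_iff₀ (by positivity)]
  refine hvol.trans ?_
  have h1 : (ε * N) ^ (n - 1) ≤ b := by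
    refine (pow_le_of_le_one (by positivity) (hNb.trans hb1) (by omega)).trans hNb
  have h2 : 2 * 8 ^ n * (ε * N) ^ (n - 1) ≤ θ := by
    have := h1.trans hbθ
    rw [le_div_iff₀ (by positivity)] at this
    linarith
  have h3 : r / (2 * N) / 4 = r / (8 * N) := by field_simp; norm_num
  have h4 : (N : ℝ) ^ n = N ^ (n - 1) * N := by
    rw [← pow_succ]; congr 1; omega
  rw [h3, div_pow, mul_pow, h4]
  have h5 : (N : ℝ) / 2 * (θ * (r ^ n / (8 ^ n * (N ^ (n - 1) * N)) * V)) =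
      θ * (r ^ n * V) / (2 * 8 ^ n * N ^ (n - 1)) := by
    field_simp
  rw [h5, le_div_iff₀ (by positivity)]
  calc ε ^ (n - 1) * (r ^ n * V) * (2 * 8 ^ n * N ^ (n - 1))
      = 2 * 8 ^ n * (ε * N) ^ (n - 1) * (r ^ n * V) := by rw [mul_pow]; ring
    _ ≤ θ * (r ^ n * V) := by gcongr

end Growth

/-- A version of Landis' growth lemma for eigenfunctions (Lemma 2.3). -/
theorem stmt_5 (n : ℕ) (hn : 2 ≤ n) :
    ∃ c₀ ε₀ c : ℝ, 0 < c₀ ∧ 0 < ε₀ ∧ 0 < c ∧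
      ∀ (lam r ε : ℝ) (x₀ : EuclideanSpace ℝ (Fin n))
        (u : EuclideanSpace ℝ (Fin n) → ℝ) (U Ω : Set (EuclideanSpace ℝ (Fin n))),
        0 < lam → 0 < r →
        IsOpen U → closedBall x₀ r ⊆ U →
        ContDiff ℝ 2 u →
        (∀ y ∈ U, lapl n u y = -lam * u y) →
        IsOpen Ω → Ω ⊆ ball x₀ r →
        IsNarrow n c₀ (1 / Real.sqrt lam) Ω →
        (∀ x ∈ frontier Ω ∩ ball x₀ r, u x = 0) →
        0 < ε → ε ≤ ε₀ →
        (volume Ω).toReal ≤ ε ^ (n - 1) * (volume (ball x₀ r)).toReal →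
        (⨆ x ∈ Ω ∩ ball x₀ (r / 2), |u x|) ≤
          Real.exp (-c / ε) * ⨆ x ∈ Ω ∩ ball x₀ r, |u x| := by
  obtain ⟨κ, θ, hκ, hθ, H⟩ := exists_growth_step n
  set μ := min 1 κ
  have hμ0 : 0 < μ := by positivity
  set b := min 1 (θ / (2 * 8 ^ n))
  have hb0 : 0 < b := by positivity
  refine ⟨θ * μ ^ n, b, b / 4, by positivity, hb0, by positivity, ?_⟩
  intro lam r ε x₀ u U Ω hlam hr _ hBU hu hlap hΩ hΩB hnar hfr hε hεb hvol
  have hΩball : Ω ∩ ball x₀ r = Ω := inter_eq_left.2 hΩB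
  have hlapΩ : ∀ x ∈ Ω, lapl n u x = -lam * u x := fun x hx =>
    hlap x (hBU (ball_subset_closedBall (hΩB hx)))
  obtain ⟨B, hB⟩ := (isCompact_closedBall x₀ r).exists_bound_of_continuousOn
    hu.continuous.continuousOn
  have hS : ∀ x ∈ Ω ∩ ball x₀ r, |u x| ≤ ⨆ x ∈ Ω ∩ ball x₀ r, |u x| := fun x hx =>
    le_biSup_abs (fun z hz => hB z (ball_subset_closedBall hz.2)) hx
  set S := ⨆ x ∈ Ω ∩ ball x₀ r, |u x|
  have hS0 : 0 ≤ S := Real.iSup_nonneg fun x => Real.iSup_nonneg fun _ => abs_nonneg _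
  have hsq : 0 < Real.sqrt lam := Real.sqrt_pos.2 hlam
  have hs₀ : 0 < μ * (1 / Real.sqrt lam) := by positivity
  have hsκ : lam * (μ * (1 / Real.sqrt lam)) ^ 2 ≤ κ := by
    have h1 : lam * (μ * (1 / Real.sqrt lam)) ^ 2 = μ ^ 2 := by
      rw [mul_pow, div_pow, Real.sq_sqrt hlam.le]
      field_simp
    rw [h1]
    exact (pow_le_of_le_one hμ0.le (min_le_left _ _) two_ne_zero).trans (min_le_right _ _)
  have hnar' : ∀ y ∈ Ω, (volume (Ω ∩ ball y (μ * (1 / Real.sqrt lam)))).toReal ≤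
      θ * (volume (ball y (μ * (1 / Real.sqrt lam)))).toReal := by
    intro y hy
    have h1 : (volume (Ω ∩ ball y (μ * (1 / Real.sqrt lam)))).toReal ≤
        (volume (Ω ∩ ball y (1 / Real.sqrt lam))).toReal :=
      ENNReal.toReal_mono (ne_top_of_le_ne_top measure_ball_lt_top.ne
        (measure_mono inter_subset_right)) (measure_mono (inter_subset_inter_right _
          (ball_subset_ball (mul_le_of_le_one_left (by positivity) (min_le_left _ _)))))
    refine (h1.trans (hnar y (subset_closure hy))).trans (le_of_eq ?_)
    rw [volume_ball_toReal y hs₀, volume_ball_toReal y (by positivity), mul_pow]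
    ring
  set N := ⌊b / ε⌋₊
  have hbε : 1 ≤ b / ε := (one_le_div hε).2 hεb
  have hN1 : 1 ≤ N := Nat.le_floor (by exact_mod_cast hbε)
  have hN0 : (1 : ℝ) ≤ N := by exact_mod_cast hN1
  have hNle : ε * N ≤ b := by
    have := Nat.floor_le (zero_le_one.trans hbε)
    rw [le_div_iff₀ hε] at this
    linarith
  have hNge : b / ε / 2 ≤ N := by
    have := Nat.lt_floor_add_one (b / ε)
    linarith
  set w := r / (2 * N) with hw
  have hw0 : 0 < w := by positivity
  set R : ℕ → ℝ := fun k => r / 2 + k * w with hR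
  have hRs : ∀ k, R (k + 1) = R k + w := fun k => by simp only [hR]; push_cast; ring
  have hRN : R N = r := by simp only [hR, hw]; field_simp; norm_num
  set F : ℕ → ℝ := fun k => (volume (Ω ∩ ball x₀ (R k))).toReal with hF
  set Q := θ * (volume (ball x₀ (w / 4))).toReal
  have hQ0 : 0 < Q := mul_pos hθ
    (ENNReal.toReal_pos (measure_ball_pos _ _ (by positivity)).ne' measure_ball_lt_top.ne)
  have hF0 : ∀ k, 0 ≤ F (k + 1) - F k := fun k => sub_nonneg.2
    (ENNReal.toReal_mono (ne_top_of_le_ne_top measure_ball_lt_top.ne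
      (measure_mono inter_subset_right)) (measure_mono (inter_subset_inter_right _
        (ball_subset_ball (by rw [hRs]; linarith)))))
  have hRle : ∀ k < N, R (k + 1) ≤ r := fun k hk => by
    rw [← hRN]
    simp only [hR]
    gcongr
    exact hk
  have hstep : ∀ k < N, ∀ M, (∀ x ∈ Ω ∩ ball x₀ (R (k + 1)), |u x| ≤ M) →
      ∀ x ∈ Ω ∩ ball x₀ (R k), |u x| ≤ Real.exp (-1 + (F (k + 1) - F k) / Q) * M := by
    intro k hk M hM x hx
    have hxM := hM x ⟨hx.1, ball_subset_ball (by rw [hRs]; linarith) hx.2⟩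
    have hM0 : 0 ≤ M := (abs_nonneg _).trans hxM
    rcases le_or_gt ((F (k + 1) - F k) / Q) 1 with h | h
    · rw [div_le_one hQ0] at h
      simp only [hF, hRs] at h hM
      have h3 := H Ω u x₀ lam _ (R k) w M hΩ hu hlam.le hs₀ hsκ hw0 hnar'
        (fun z hz => hfr z ⟨hz.1, ball_subset_ball (by rw [← hRs]; exact hRle k hk) hz.2⟩)
        hlapΩ hM h x hx
      have h4 : 1 / 3 ≤ Real.exp (-1 + (F (k + 1) - F k) / Q) := by
        refine le_trans ?_ (Real.exp_le_exp.2 (le_add_of_nonneg_right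
          (div_nonneg (hF0 k) hQ0.le)))
        rw [Real.exp_neg, one_div]
        exact inv_anti₀ (Real.exp_pos 1) Real.exp_one_lt_three.le
      nlinarith [mul_le_mul_of_nonneg_right h4 hM0]
    · refine hxM.trans (le_mul_of_one_le_left hM0 (Real.one_le_exp (by linarith)))
  have hsum : ∑ k ∈ Finset.range N, (F (k + 1) - F k) / Q ≤ N / 2 := by
    rw [← Finset.sum_div, Finset.sum_range_sub]
    refine le_trans ?_ (volume_div_le x₀ hn hr hε hθ hN1 (min_le_left _ _) (min_le_right _ _)
      hNle hvol)
    refine div_le_div_of_nonneg_right ?_ hQ0.le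
    have h1 : F N = (volume Ω).toReal := by simp only [hF, hRN, hΩball]
    have h2 : 0 ≤ F 0 := ENNReal.toReal_nonneg
    linarith
  have hexp : Real.exp (-N + ∑ k ∈ Finset.range N, (F (k + 1) - F k) / Q) ≤
      Real.exp (-(b / 4) / ε) := by
    refine Real.exp_le_exp.2 ?_
    have : -(b / 4) / ε = -(b / ε / 2) / 2 := by ring
    rw [this]
    linarith
  refine Real.iSup_le (fun x => Real.iSup_le (fun hx => ?_) (by positivity)) (by positivity)
  have hR0 : R 0 = r / 2 := by simp [hR]
  rw [← hR0] at hx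
  rw [← hRN] at hS
  exact (abs_le_exp_mul_of_steps N hstep hS x hx).trans (mul_le_mul_of_nonneg_right hexp hS0)
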